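/- Let ε > 0 and let n be an integer with εn ≥ 3. Let H be a 3-uniform hypergraph on n vertices with δ₂(H) ≥ (1/3 + ε)n containing no homomorphic copy of the tight cycle C₁₁. Then every vertex v of H with d_D⁻(v) > 0 satisfies d_D⁻(v) ≥ (1/3 + ε)n, where d_D⁻(v) is the in-degree of v in the apex digraph D. -/

import Mathlib

open Finset

/-- A 3-uniform hypergraph given by its edge set: every edge has exactly 3 vertices. -/
def IsUniform3 {V : Type*} (H : Finset (Finset V)) : Prop :=
  ∀ e ∈ H, e.card = 3

/-- The codegree of a pair of vertices: the number of vertices `w` with `{u,v,w} ∈ H`. -/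
noncomputable def codeg {V : Type*} [DecidableEq V] (H : Finset (Finset V)) (u v : V) : ℕ :=
  {w : V | ({u, v, w} : Finset V) ∈ H}.ncard

/-- The minimum codegree `δ₂(H)`: the minimum of `codeg H u v` over pairs of distinct vertices. -/
noncomputable def minCodeg {V : Type*} [DecidableEq V] (H : Finset (Finset V)) : ℕ :=
  sInf {d : ℕ | ∃ u v : V, u ≠ v ∧ codeg H u v = d}

/-- `H` contains a homomorphic copy of the tight cycle `C_ℓ`: a cyclic sequence of vertices
(indexed by `ZMod ℓ`, not necessarily distinct) in which every three cyclically consecutive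
vertices are pairwise distinct and form an edge of `H`. -/
def HasHomTightCycle {V : Type*} [DecidableEq V] (ℓ : ℕ) (H : Finset (Finset V)) : Prop :=
  ∃ x : ZMod ℓ → V, ∀ i : ZMod ℓ,
    x (i - 1) ≠ x i ∧ x i ≠ x (i + 1) ∧ x (i - 1) ≠ x (i + 1) ∧
      ({x (i - 1), x i, x (i + 1)} : Finset V) ∈ H

/-- `H` contains a (genuine) copy of the tight cycle `C_ℓ`: `ℓ` distinct vertices, cyclically
ordered, such that every three cyclically consecutive vertices form an edge of `H`. -/
def HasTightCycle {V : Type*} [DecidableEq V] (ℓ : ℕ) (H : Finset (Finset V)) : Prop :=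
  ∃ x : ZMod ℓ → V, Function.Injective x ∧
    ∀ i : ZMod ℓ, ({x (i - 1), x i, x (i + 1)} : Finset V) ∈ H

/-- The arc `u → v` of the apex digraph `D`: some `K₄⁻` of `H` contains `u` and `v`
with apex `v`; i.e. there are two further vertices `a, b` (with `u,v,a,b` distinct)
such that the three edges through `v` on `{u,v,a,b}` all lie in `H`. -/
def ArcD {V : Type*} [DecidableEq V] (H : Finset (Finset V)) (u v : V) : Prop :=
  ∃ a b : V, ({u, v, a, b} : Finset V).card = 4 ∧
    ({v, u, a} : Finset V) ∈ H ∧ ({v, u, b} : Finset V) ∈ H ∧ ({v, a, b} : Finset V) ∈ H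

/-- `{u,v}` is a base pair: some `K₄⁻` of `H` contains `u` and `v` with neither `u` nor
`v` being the apex; i.e. there are further vertices `w, a` (with `u,v,w,a` distinct) with
apex `w`, so that the three edges through `w` on `{u,v,w,a}` all lie in `H`. -/
def BasePair {V : Type*} [DecidableEq V] (H : Finset (Finset V)) (u v : V) : Prop :=
  ∃ w a : V, ({u, v, w, a} : Finset V).card = 4 ∧
    ({w, u, v} : Finset V) ∈ H ∧ ({w, u, a} : Finset V) ∈ H ∧ ({w, v, a} : Finset V) ∈ H

/-- The degree of `v` in the base-pair graph `B`. -/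
noncomputable def degB {V : Type*} [DecidableEq V] (H : Finset (Finset V)) (v : V) : ℕ :=
  {u : V | BasePair H u v}.ncard

/-- The out-degree of `v` in the apex digraph `D`. -/
noncomputable def outDegD {V : Type*} [DecidableEq V] (H : Finset (Finset V)) (v : V) : ℕ :=
  {u : V | ArcD H v u}.ncard

/-- The in-degree of `v` in the apex digraph `D`. -/
noncomputable def inDegD {V : Type*} [DecidableEq V] (H : Finset (Finset V)) (v : V) : ℕ :=
  {u : V | ArcD H u v}.ncard

/-- The codegree Turán number `ex₂(n, C_ℓ)`: the maximum of `δ₂(H)` over all 3-uniform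
hypergraphs `H` on `n` vertices containing no copy of the tight cycle `C_ℓ`. -/
noncomputable def exCodeg (ℓ n : ℕ) : ℕ :=
  sSup {k : ℕ | ∃ H : Finset (Finset (Fin n)),
    IsUniform3 H ∧ ¬ HasTightCycle ℓ H ∧ minCodeg H = k}

/-- An edge of a 3-uniform hypergraph written as `{a, b, c}` has three distinct vertices. -/
lemma IsUniform3.ne_of_mem {V : Type*} [DecidableEq V] {H : Finset (Finset V)}
    (hH : IsUniform3 H) {a b c : V} (h : ({a, b, c} : Finset V) ∈ H) :
    a ≠ b ∧ b ≠ c ∧ a ≠ c := by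
  have hcard := hH _ h
  refine ⟨?_, ?_, ?_⟩ <;> rintro rfl
  · simp only [Finset.mem_insert, Finset.mem_singleton, true_or, Finset.insert_eq_of_mem] at hcard
    exact absurd hcard (by have := Finset.card_le_two (a := a) (b := c); omega)
  · simp only [Finset.mem_singleton, Finset.insert_eq_of_mem] at hcard
    exact absurd hcard (by have := Finset.card_le_two (a := a) (b := b); omega)
  · rw [Finset.insert_eq_of_mem (by simp)] at hcard
    exact absurd hcard (by have := Finset.card_le_two (a := b) (b := a); omega)

/-- In a 3-uniform hypergraph, consecutive edges suffice for a homomorphic tight cycle. -/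
lemma IsUniform3.hasHomTightCycle {V : Type*} [DecidableEq V] {H : Finset (Finset V)}
    (hH : IsUniform3 H) {l : ℕ} (x : ZMod l → V)
    (hx : ∀ i, ({x (i - 1), x i, x (i + 1)} : Finset V) ∈ H) : HasHomTightCycle l H :=
  ⟨x, fun i => ⟨(hH.ne_of_mem (hx i)).1, (hH.ne_of_mem (hx i)).2.1,
    (hH.ne_of_mem (hx i)).2.2, hx i⟩⟩

/-- A triangle `abc` in the link of `v`, a link edge `ax` and a `K₄⁻` with apex `a`
containing `v` and `x` yield a homomorphic `C₁₁`. -/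
lemma hasHomTightCycle_of_apex_common {V : Type*} [DecidableEq V] {H : Finset (Finset V)}
    (hH : IsUniform3 H) {v a b c x w : V} (hab : ({v, a, b} : Finset V) ∈ H)
    (hac : ({v, a, c} : Finset V) ∈ H) (hbc : ({v, b, c} : Finset V) ∈ H)
    (hax : ({v, a, x} : Finset V) ∈ H) (haw : ({v, a, w} : Finset V) ∈ H)
    (hxw : ({a, x, w} : Finset V) ∈ H) : HasHomTightCycle 11 H := by
  refine hH.hasHomTightCycle (l := 11) (![b, a, v, b, c, v, a, x, w, a, v] : Fin 11 → V) ?_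
  intro i
  fin_cases i
  · change ({v, b, a} : Finset V) ∈ H; convert hab using 1; grind
  · change ({b, a, v} : Finset V) ∈ H; convert hab using 1; grind
  · change ({a, v, b} : Finset V) ∈ H; convert hab using 1; grind
  · change ({v, b, c} : Finset V) ∈ H; exact hbc
  · change ({b, c, v} : Finset V) ∈ H; convert hbc using 1; grind
  · change ({c, v, a} : Finset V) ∈ H; convert hac using 1; grind
  · change ({v, a, x} : Finset V) ∈ H; exact hax
  · change ({a, x, w} : Finset V) ∈ H; exact hxw
  · change ({x, w, a} : Finset V) ∈ H; convert hxw using 1; grind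
  · change ({w, a, v} : Finset V) ∈ H; convert haw using 1; grind
  · change ({a, v, b} : Finset V) ∈ H; convert hab using 1; grind

/-- A triangle `abc` in the link of `v`, a link edge `ax` and a `K₄⁻` with apex `x`
containing `v` and `a` yield a homomorphic `C₁₁`. -/
lemma hasHomTightCycle_of_apex_outer {V : Type*} [DecidableEq V] {H : Finset (Finset V)}
    (hH : IsUniform3 H) {v a b c x w : V} (hab : ({v, a, b} : Finset V) ∈ H)
    (hac : ({v, a, c} : Finset V) ∈ H) (hbc : ({v, b, c} : Finset V) ∈ H)
    (hax : ({v, a, x} : Finset V) ∈ H) (hvxw : ({v, x, w} : Finset V) ∈ H)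
    (haxw : ({a, x, w} : Finset V) ∈ H) : HasHomTightCycle 11 H := by
  refine hH.hasHomTightCycle (l := 11) (![b, a, v, x, w, a, x, v, a, c, v] : Fin 11 → V) ?_
  intro i
  fin_cases i
  · change ({v, b, a} : Finset V) ∈ H; convert hab using 1; grind
  · change ({b, a, v} : Finset V) ∈ H; convert hab using 1; grind
  · change ({a, v, x} : Finset V) ∈ H; convert hax using 1; grind
  · change ({v, x, w} : Finset V) ∈ H; exact hvxw
  · change ({x, w, a} : Finset V) ∈ H; convert haxw using 1; grind
  · change ({w, a, x} : Finset V) ∈ H; convert haxw using 1; grind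
  · change ({a, x, v} : Finset V) ∈ H; convert hax using 1; grind
  · change ({x, v, a} : Finset V) ∈ H; convert hax using 1; grind
  · change ({v, a, c} : Finset V) ∈ H; exact hac
  · change ({a, c, v} : Finset V) ∈ H; convert hac using 1; grind
  · change ({c, v, b} : Finset V) ∈ H; convert hbc using 1; grind

lemma minCodeg_le_codeg {V : Type*} [DecidableEq V] (H : Finset (Finset V)) {u v : V}
    (h : u ≠ v) : minCodeg H ≤ codeg H u v :=
  Nat.sInf_le ⟨u, v, h, rfl⟩

/-- Three finite sets of total size exceeding that of the ambient type are not
pairwise disjoint. -/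
lemma exists_mem_two_of_card_lt {α : Type*} [Fintype α] {A B C : Set α}
    (h : Fintype.card α < A.ncard + B.ncard + C.ncard) :
    ∃ w, (w ∈ A ∧ w ∈ B) ∨ (w ∈ A ∧ w ∈ C) ∨ (w ∈ B ∧ w ∈ C) := by
  by_contra! hcon
  have hAB : Disjoint A B := Set.disjoint_left.mpr fun w ha hb => (hcon w).1 ha hb
  have hABC : Disjoint (A ∪ B) C := by
    refine Set.disjoint_left.mpr fun w hw hc => ?_
    rcases hw with ha | hb
    · exact (hcon w).2.1 ha hc
    · exact (hcon w).2.2 hb hc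
  have hle := Set.ncard_le_card (A ∪ B ∪ C)
  rw [Set.ncard_union_eq hABC, Set.ncard_union_eq hAB] at hle
  rw [Nat.card_eq_fintype_card] at hle
  omega

/-- If `ε > 0`, `εn ≥ 3` and `H` is a 3-uniform hypergraph on `n` vertices with
`δ₂(H) ≥ (1/3 + ε)n` and no homomorphic copy of `C₁₁`, then every vertex `v` with
`d_D⁻(v) > 0` satisfies `d_D⁻(v) ≥ (1/3 + ε)n`. -/
theorem inDegD_pos_imp_inDegD_large {n : ℕ} (ε : ℝ) (hε : 0 < ε) (hεn : (3 : ℝ) ≤ ε * n)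
    (H : Finset (Finset (Fin n))) (hH : IsUniform3 H)
    (hδ : ((1 / 3 : ℝ) + ε) * n ≤ (minCodeg H : ℝ))
    (hfree : ¬ HasHomTightCycle 11 H) :
    ∀ v : Fin n, 0 < inDegD H v → ((1 / 3 : ℝ) + ε) * n ≤ (inDegD H v : ℝ) := by
  intro v hv
  obtain ⟨a, b, c, hab, hac, hbc⟩ : ∃ a b c : Fin n, ({v, a, b} : Finset (Fin n)) ∈ H ∧
      ({v, a, c} : Finset (Fin n)) ∈ H ∧ ({v, b, c} : Finset (Fin n)) ∈ H := by
    obtain ⟨u, a, b, -, h⟩ := Set.nonempty_of_ncard_ne_zero hv.ne'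
    exact ⟨u, a, b, h⟩
  have hsub : {x | ({v, a, x} : Finset (Fin n)) ∈ H} ⊆ {x | ArcD H x v} := by
    intro x hax
    rw [Set.mem_ofPred_eq] at hax
    obtain ⟨hva, hax', hvx⟩ := hH.ne_of_mem hax
    have hsum : Fintype.card (Fin n) < codeg H v a + codeg H v x + codeg H a x := by
      have h1 := minCodeg_le_codeg H hva
      have h2 := minCodeg_le_codeg H hvx
      have h3 := minCodeg_le_codeg H hax'
      have hlt : (n : ℝ) < 3 * (minCodeg H : ℝ) := by nlinarith
      have hlt' : n < 3 * minCodeg H := by exact_mod_cast hlt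
      rw [Fintype.card_fin]
      omega
    obtain ⟨w, ⟨haw, hxw⟩ | ⟨haw, haxw⟩ | ⟨hxw, haxw⟩⟩ := exists_mem_two_of_card_lt hsum
    · rw [Set.mem_ofPred_eq] at haw hxw
      obtain ⟨-, haw', hvw⟩ := hH.ne_of_mem haw
      obtain ⟨-, hxw', -⟩ := hH.ne_of_mem hxw
      refine ⟨a, w, ?_, ?_, hxw, haw⟩
      · have hxv := hvx.symm
        have hxa := hax'.symm
        simp [*]
      · convert hax using 1; grind
    · exact (hfree (hasHomTightCycle_of_apex_common hH hab hac hbc hax haw haxw)).elim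
    · exact (hfree (hasHomTightCycle_of_apex_outer hH hab hac hbc hax hxw haxw)).elim
  have hcodeg : codeg H v a ≤ inDegD H v := Set.ncard_le_ncard hsub
  have hmin := (minCodeg_le_codeg H (hH.ne_of_mem hab).1).trans hcodeg
  exact hδ.trans (by exact_mod_cast hmin)
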